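/- Let ν ∈ (0,1) and let V : ℝ³ → ℝ satisfy V(x) ≤ 0 and |x|·|V(x)| ≤ ν for all x ≠ 0. Then for every φ ∈ C_c^∞(ℝ³,ℂ²), −∫_{ℝ³} V |φ|² dx ≤ ν ∫_{ℝ³} ( |σ·∇φ|² / (1 + 1/|x|) + |φ|² ) dx. -/

import Mathlib

open MeasureTheory

noncomputable section

/-- `σ·∇φ`, built from the Pauli matrices `σ₁ = [[0,1],[1,0]]`, `σ₂ = [[0,-i],[i,0]]`,
`σ₃ = [[1,0],[0,-1]]` acting on the partial derivatives of `φ`: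
`σ·∇φ = σ₁ ∂₁φ + σ₂ ∂₂φ + σ₃ ∂₃φ`. -/
def pauliGrad (φ : EuclideanSpace ℝ (Fin 3) → EuclideanSpace ℂ (Fin 2))
    (x : EuclideanSpace ℝ (Fin 3)) : EuclideanSpace ℂ (Fin 2) :=
  let d : Fin 3 → EuclideanSpace ℂ (Fin 2) :=
    fun k => fderiv ℝ φ x (EuclideanSpace.single k (1 : ℝ))
  (WithLp.equiv 2 (Fin 2 → ℂ)).symm
    ![ d 0 1 - Complex.I * d 1 1 + d 2 0,
       d 0 0 + Complex.I * d 1 0 - d 2 1 ]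

/-- `φ ∈ C_c^∞(ℝ³, ℂ²)`: smooth and compactly supported. -/
def IsTestFun (φ : EuclideanSpace ℝ (Fin 3) → EuclideanSpace ℂ (Fin 2)) : Prop :=
  ContDiff ℝ (⊤ : ℕ∞) φ ∧ HasCompactSupport φ

open Filter Topology

/-- Three-dimensional Euclidean space. -/
abbrev Space3 := EuclideanSpace ℝ (Fin 3)

lemma ae_ne_zero : ∀ᵐ x : Space3, x ≠ 0 := by
  simp [ae_iff]

lemma aestronglyMeasurable_of_continuousAt {g : Space3 → ℝ}
    (hg : ∀ x, x ≠ 0 → ContinuousAt g x) : AEStronglyMeasurable g := by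
  have h : ContinuousOn g {0}ᶜ := fun x hx => (hg x hx).continuousWithinAt
  have := h.aestronglyMeasurable (μ := volume) (measurableSet_singleton (0 : Space3)).compl
  rwa [restrict_compl_singleton] at this

lemma integrable_inv_norm_mul {ψ : Space3 → ℝ} {C : ℝ} (hψ : AEStronglyMeasurable ψ)
    (hb : ∀ x, x ≠ 0 → |ψ x| ≤ C) (hc : HasCompactSupport ψ) :
    Integrable (fun x => ‖x‖⁻¹ * ψ x) := by
  obtain ⟨R, hR⟩ := hc.isCompact.isBounded.subset_ball (0 : Space3)
  have h1 : IntegrableOn (fun x : Space3 => ‖x‖⁻¹) (Metric.ball 0 R) := by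
    refine (integrableOn_fun_norm_addHaar volume (f := fun y : ℝ => y⁻¹) (r := R)).2 ?_
    have h2 : IntegrableOn (fun y : ℝ => y) (Set.Ioo 0 R) :=
      (continuous_id.integrableOn_Icc).mono_set Set.Ioo_subset_Icc_self
    refine h2.congr_fun (fun y hy => ?_) measurableSet_Ioo
    have : y ≠ 0 := hy.1.ne'
    simp
    field_simp
  have h3 : IntegrableOn (fun x => ‖x‖⁻¹ * ψ x) (Metric.ball 0 R) := by
    refine h1.mul_bdd (c := C) hψ.restrict (ae_restrict_of_ae ?_)
    filter_upwards [ae_ne_zero] with x hx using hb x hx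
  refine (integrableOn_iff_integrable_of_support_subset ?_).1 h3
  exact (Function.support_mul_subset_right _ _).trans ((subset_tsupport _).trans hR)

lemma integrable_of_bounded_of_compactSupport {ψ : Space3 → ℝ} {C : ℝ}
    (hψ : AEStronglyMeasurable ψ) (hb : ∀ x, x ≠ 0 → |ψ x| ≤ C) (hc : HasCompactSupport ψ) :
    Integrable ψ := by
  refine (integrableOn_iff_integrable_of_support_subset (subset_tsupport ψ)).1 ?_
  refine Measure.integrableOn_of_bounded (M := C) hc.isCompact.measure_lt_top.ne hψ
    (ae_restrict_of_ae ?_)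
  filter_upwards [ae_ne_zero] with x hx using hb x hx

lemma integral_fderiv_apply_eq_zero {g : Space3 → ℝ} {g' : Space3 → Space3 →L[ℝ] ℝ} (v : Space3)
    (hg : ∀ x, HasFDerivAt g (g' x) x) (hi : Integrable g) (hi' : Integrable (fun x => g' x v)) :
    ∫ x, g' x v = 0 := by
  have := integral_bilinear_hasFDerivAt_right_eq_neg_left_of_integrable (μ := volume)
    (f := fun _ : Space3 => (1 : ℝ)) (f' := fun _ => 0) (g := g) (g' := g') (v := v)
    (B := ContinuousLinearMap.mul ℝ ℝ)
    (by simp) (by simpa using hi') (by simpa using hi) (fun x _ => hasFDerivAt_const _ _)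
    (fun x _ => hg x)
  simpa using this

lemma hasFDerivAt_cutoff (x : Space3) {e : ℝ} (he : 0 < e) :
    HasFDerivAt (fun x : Space3 => ‖x‖ ^ 2 / (‖x‖ ^ 2 + e))
      ((2 * e / (‖x‖ ^ 2 + e) ^ 2) • innerSL ℝ x) x := by
  have h := (hasStrictFDerivAt_norm_sq x).hasFDerivAt
  have hne : ‖x‖ ^ 2 + e ≠ 0 := by positivity
  have h1 : HasDerivAt (fun t : ℝ => t / (t + e)) (e / (‖x‖ ^ 2 + e) ^ 2) (‖x‖ ^ 2) := by
    refine ((hasDerivAt_id (‖x‖ ^ 2)).div ((hasDerivAt_id (‖x‖ ^ 2)).add_const e)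
      hne).congr_deriv ?_
    simp
  refine (h1.comp_hasFDerivAt x h).congr_fderiv ?_
  ext v
  simp
  ring

/-- An isolated singularity at which the function stays bounded does not contribute to the
integral of a directional derivative. -/
lemma integral_fderiv_apply_eq_zero_of_bounded {g : Space3 → ℝ} {g' : Space3 → Space3 →L[ℝ] ℝ}
    {C : ℝ} (v : Space3) (hg : ∀ x, x ≠ 0 → HasFDerivAt g (g' x) x)
    (hb : ∀ x, x ≠ 0 → |g x| ≤ C) (hc : HasCompactSupport g)
    (hi' : Integrable (fun x => g' x v)) : ∫ x, g' x v = 0 := by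
  have hmeas : AEStronglyMeasurable g :=
    aestronglyMeasurable_of_continuousAt fun x hx => (hg x hx).continuousAt
  have hi : Integrable g := integrable_of_bounded_of_compactSupport hmeas hb hc
  have hinv : Integrable (fun x => ‖x‖⁻¹ * g x) := integrable_inv_norm_mul hmeas hb hc
  let e : ℕ → ℝ := fun n => 1 / ((n : ℝ) + 1)
  have he : ∀ n, 0 < e n := fun n => by positivity
  let F : ℕ → Space3 → Space3 →L[ℝ] ℝ := fun n x =>
    (‖x‖ ^ 2 / (‖x‖ ^ 2 + e n)) • g' x + g x • ((2 * e n / (‖x‖ ^ 2 + e n) ^ 2) • innerSL ℝ x)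
  have hFv : ∀ n x, F n x v = ‖x‖ ^ 2 / (‖x‖ ^ 2 + e n) * g' x v +
      g x * (2 * e n / (‖x‖ ^ 2 + e n) ^ 2 * inner ℝ x v) := fun n x => by simp [F]
  have hFm : ∀ n, AEStronglyMeasurable (fun x => F n x v) := by
    intro n
    simp only [hFv]
    have hcont : Continuous fun x : Space3 => ‖x‖ ^ 2 / (‖x‖ ^ 2 + e n) :=
      (by fun_prop : Continuous fun x : Space3 => ‖x‖ ^ 2).div (by fun_prop)
        fun x => by have := he n; positivity
    have hcont' : Continuous fun x : Space3 =>
        2 * e n / (‖x‖ ^ 2 + e n) ^ 2 * inner ℝ x v :=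
      (continuous_const.div (by fun_prop) fun x => by have := he n; positivity).mul
        (by fun_prop)
    exact (hcont.aestronglyMeasurable.mul hi'.1).add (hmeas.mul hcont'.aestronglyMeasurable)
  have hbound : Integrable (fun x => |g' x v| + ‖v‖ * |‖x‖⁻¹ * g x|) :=
    hi'.abs.add (hinv.abs.const_mul _)
  have hle : ∀ n, ∀ᵐ x : Space3, ‖F n x v‖ ≤ |g' x v| + ‖v‖ * |‖x‖⁻¹ * g x| := by
    intro n
    filter_upwards [ae_ne_zero] with x hx
    have hr : 0 < ‖x‖ := norm_pos_iff.2 hx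
    have hen := he n
    rw [hFv, Real.norm_eq_abs]
    refine (abs_add_le _ _).trans (add_le_add ?_ ?_)
    · rw [abs_mul, abs_of_nonneg (by positivity)]
      refine mul_le_of_le_one_left (abs_nonneg _) ?_
      rw [div_le_one (by positivity)]
      linarith
    · have h1 : |2 * e n / (‖x‖ ^ 2 + e n) ^ 2 * inner ℝ x v| ≤ ‖v‖ * ‖x‖⁻¹ := by
        rw [abs_mul, abs_of_nonneg (by positivity)]
        calc _ ≤ 2 * e n / (‖x‖ ^ 2 + e n) ^ 2 * (‖x‖ * ‖v‖) := by
              gcongr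
              exact abs_real_inner_le_norm x v
          _ = (2 * e n * ‖x‖ ^ 2 / (‖x‖ ^ 2 + e n) ^ 2) * (‖v‖ * ‖x‖⁻¹) := by
              field_simp
          _ ≤ 1 * (‖v‖ * ‖x‖⁻¹) := by
              gcongr
              rw [div_le_one (by positivity)]
              nlinarith [sq_nonneg (‖x‖ ^ 2), sq_nonneg (e n)]
          _ = _ := one_mul _
      rw [abs_mul (g x), abs_mul ‖x‖⁻¹, abs_of_pos (inv_pos.2 hr)]
      nlinarith [mul_le_mul_of_nonneg_left h1 (abs_nonneg (g x))]
  have hlim : ∀ᵐ x : Space3, Tendsto (fun n => F n x v) atTop (𝓝 (g' x v)) := by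
    have h0 : Tendsto e atTop (𝓝 0) := tendsto_one_div_add_atTop_nhds_zero_nat
    filter_upwards [ae_ne_zero] with x hx
    have hr : ‖x‖ ≠ 0 := norm_ne_zero_iff.2 hx
    have hcont : ContinuousAt (fun t : ℝ => ‖x‖ ^ 2 / (‖x‖ ^ 2 + t) * g' x v +
      g x * (2 * t / (‖x‖ ^ 2 + t) ^ 2 * inner ℝ x v)) 0 := by
      have hne : ‖x‖ ^ 2 + 0 ≠ 0 := by simpa using hr
      have hne' : (‖x‖ ^ 2 + 0) ^ 2 ≠ 0 := pow_ne_zero _ hne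
      fun_prop (disch := assumption)
    have := hcont.tendsto.comp h0
    simp only [add_zero, div_self (pow_ne_zero 2 hr), mul_zero, zero_div, zero_mul, one_mul]
      at this
    simpa only [hFv, Function.comp_def] using this
  have hder : ∀ n x, HasFDerivAt (fun x => ‖x‖ ^ 2 / (‖x‖ ^ 2 + e n) * g x) (F n x) x := by
    intro n x
    rcases eq_or_ne x 0 with rfl | hx
    · have hF0 : F n 0 = 0 := by ext; simp [F]
      rw [hF0]
      refine HasFDerivAt.of_isLittleO ?_
      have hO : (fun x => ‖x‖ ^ 2 / (‖x‖ ^ 2 + e n) * g x) =O[𝓝 (0 : Space3)]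
          fun x => ‖x‖ ^ 2 := by
        refine Asymptotics.IsBigO.of_bound (C / e n) (Eventually.of_forall fun x => ?_)
        rcases eq_or_ne x 0 with rfl | hx
        · simp
        have hen := he n
        rw [Real.norm_eq_abs, Real.norm_eq_abs, abs_mul, abs_of_nonneg (by positivity),
          abs_of_nonneg (by positivity : 0 ≤ ‖x‖ ^ 2)]
        calc _ ≤ ‖x‖ ^ 2 / (0 + e n) * C := by
              gcongr
              · positivity
              · exact hb x hx
          _ = _ := by rw [zero_add]; ring
      have ho : (fun x : Space3 => ‖x‖ ^ 2) =o[𝓝 (0 : Space3)] fun x => x :=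
        Asymptotics.isLittleO_norm_pow_id (by norm_num)
      simpa using hO.trans_isLittleO ho
    · exact (hasFDerivAt_cutoff x (he n)).mul (hg x hx)
  have hzero : ∀ n, ∫ x, F n x v = 0 := by
    intro n
    refine integral_fderiv_apply_eq_zero v (hder n) ?_ (hbound.mono' (hFm n) (hle n))
    have hcont : Continuous fun x => ‖x‖ ^ 2 / (‖x‖ ^ 2 + e n) :=
      continuous_iff_continuousAt.2 fun x => (hasFDerivAt_cutoff x (he n)).continuousAt
    refine hi.bdd_mul (c := 1) hcont.aestronglyMeasurable (ae_of_all _ fun x => ?_)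
    have hen := he n
    rw [Real.norm_eq_abs, abs_of_nonneg (by positivity), div_le_one (by positivity)]
    linarith
  have := tendsto_integral_of_dominated_convergence _ hFm hbound hle hlim
  simp only [hzero] at this
  exact tendsto_nhds_unique this tendsto_const_nhds

lemma hasFDerivAt_norm_of_ne_zero {x : Space3} (hx : x ≠ 0) :
    HasFDerivAt (fun x : Space3 => ‖x‖) (‖x‖⁻¹ • innerSL ℝ x) x := by
  have hr : ‖x‖ ≠ 0 := norm_ne_zero_iff.2 hx
  have h := (hasStrictFDerivAt_norm_sq x).hasFDerivAt.sqrt (pow_ne_zero 2 hr)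
  simp only [Real.sqrt_sq (norm_nonneg _)] at h
  refine h.congr_fderiv ?_
  ext v
  simp
  field_simp

/-- A weight `a` with derivative `a'` which is bounded together with `‖x‖ * a'` away from the
origin. -/
def IsTame (a : Space3 → ℝ) (a' : Space3 → Space3 →L[ℝ] ℝ) : Prop :=
  ∃ C : ℝ, ∀ x, x ≠ 0 → HasFDerivAt a (a' x) x ∧ |a x| ≤ C ∧ ‖x‖ * ‖a' x‖ ≤ C

namespace IsTame

variable {a b : Space3 → ℝ} {a' b' : Space3 → Space3 →L[ℝ] ℝ}

lemma mul (ha : IsTame a a') (hb : IsTame b b') :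
    IsTame (fun x => a x * b x) (fun x => a x • b' x + b x • a' x) := by
  obtain ⟨A, hA⟩ := ha
  obtain ⟨B, hB⟩ := hb
  refine ⟨2 * (A * B), fun x hx => ?_⟩
  obtain ⟨ha, ha1, ha2⟩ := hA x hx
  obtain ⟨hb, hb1, hb2⟩ := hB x hx
  have hA0 : 0 ≤ A := (abs_nonneg _).trans ha1
  have hB0 : 0 ≤ B := (abs_nonneg _).trans hb1
  refine ⟨ha.mul hb, ?_, ?_⟩
  · rw [abs_mul]
    nlinarith [mul_le_mul ha1 hb1 (abs_nonneg _) hA0]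
  · have h1 : ‖a x • b' x + b x • a' x‖ ≤ |a x| * ‖b' x‖ + |b x| * ‖a' x‖ := by
      refine (norm_add_le _ _).trans ?_
      rw [norm_smul, norm_smul, Real.norm_eq_abs, Real.norm_eq_abs]
    have h2 := mul_le_mul_of_nonneg_left h1 (norm_nonneg x)
    have h3 := mul_le_mul ha1 hb2 (by positivity) hA0
    have h4 := mul_le_mul hb1 ha2 (by positivity) hB0
    linarith

lemma one_sub (ha : IsTame a a') : IsTame (fun x => 1 - a x) (fun x => -a' x) := by
  obtain ⟨A, hA⟩ := ha
  refine ⟨1 + A, fun x hx => ?_⟩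
  obtain ⟨ha, ha1, ha2⟩ := hA x hx
  refine ⟨ha.const_sub 1, ?_, ?_⟩
  · rw [abs_le] at ha1 ⊢
    constructor <;> linarith
  · rw [norm_neg]
    linarith

lemma aestronglyMeasurable (ha : IsTame a a') : AEStronglyMeasurable a := by
  obtain ⟨A, hA⟩ := ha
  exact aestronglyMeasurable_of_continuousAt fun x hx => (hA x hx).1.continuousAt

lemma aestronglyMeasurable_deriv (ha : IsTame a a') (v : Space3) :
    AEStronglyMeasurable (fun x => a' x v) := by
  obtain ⟨A, hA⟩ := ha
  refine (measurable_fderiv_apply_const ℝ a v).aestronglyMeasurable.congr ?_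
  filter_upwards [ae_ne_zero] with x hx
  rw [(hA x hx).1.fderiv]

lemma integrable_mul (ha : IsTame a a') {ψ : Space3 → ℝ} (hψ : Continuous ψ)
    (hc : HasCompactSupport ψ) : Integrable (fun x => a x * ψ x) := by
  have hm := ha.aestronglyMeasurable
  obtain ⟨A, hA⟩ := ha
  refine (hψ.integrable_of_hasCompactSupport hc).bdd_mul (c := A) hm ?_
  filter_upwards [ae_ne_zero] with x hx using (hA x hx).2.1

lemma integrable_deriv_mul (ha : IsTame a a') (v : Space3) {ψ : Space3 → ℝ} (hψ : Continuous ψ)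
    (hc : HasCompactSupport ψ) : Integrable (fun x => a' x v * ψ x) := by
  have hm := ha.aestronglyMeasurable_deriv v
  obtain ⟨A, hA⟩ := ha
  obtain ⟨C, hC⟩ := hc.exists_bound_of_continuous hψ
  have h := (integrable_inv_norm_mul hψ.aestronglyMeasurable (fun x _ => hC x) hc).norm.const_mul
    (A * ‖v‖)
  refine h.mono' (hm.mul hψ.aestronglyMeasurable) ?_
  filter_upwards [ae_ne_zero] with x hx
  have hr : 0 < ‖x‖ := norm_pos_iff.2 hx
  have h1 : ‖a' x v‖ ≤ A * ‖v‖ * ‖x‖⁻¹ := by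
    have h2 : ‖a' x‖ ≤ A * ‖x‖⁻¹ := by
      rw [← div_eq_mul_inv, le_div_iff₀' hr]
      exact (hA x hx).2.2
    calc _ ≤ ‖a' x‖ * ‖v‖ := (a' x).le_opNorm v
      _ ≤ A * ‖x‖⁻¹ * ‖v‖ := by gcongr
      _ = _ := by ring
  rw [norm_mul, norm_mul, norm_inv, norm_norm, ← mul_assoc]
  gcongr

/-- Integration by parts against a tame weight. -/
lemma integral_deriv_mul_add (ha : IsTame a a') (v : Space3) {ψ : Space3 → ℝ}
    (hψ : ContDiff ℝ 1 ψ) (hc : HasCompactSupport ψ) :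
    Integrable (fun x => a' x v * ψ x + a x * fderiv ℝ ψ x v) ∧
      ∫ x, (a' x v * ψ x + a x * fderiv ℝ ψ x v) = 0 := by
  have hi : Integrable (fun x => a' x v * ψ x + a x * fderiv ℝ ψ x v) :=
    (ha.integrable_deriv_mul v hψ.continuous hc).add
      (ha.integrable_mul ((hψ.continuous_fderiv one_ne_zero).clm_apply continuous_const)
        (hc.fderiv_apply ℝ v))
  refine ⟨hi, ?_⟩
  obtain ⟨A, hA⟩ := ha
  obtain ⟨C, hC⟩ := hc.exists_bound_of_continuous hψ.continuous
  have heq : ∀ x, (a x • fderiv ℝ ψ x + ψ x • a' x) v = a' x v * ψ x + a x * fderiv ℝ ψ x v := by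
    intro x
    simp
    ring
  simp only [← heq] at hi ⊢
  refine integral_fderiv_apply_eq_zero_of_bounded (g := fun x => a x * ψ x) (C := A * C) v
    (fun x hx => (hA x hx).1.mul (hψ.differentiable one_ne_zero x).hasFDerivAt)
    (fun x hx => ?_) hc.mul_left hi
  rw [abs_mul]
  exact mul_le_mul (hA x hx).2.1 (hC x) (abs_nonneg _) ((abs_nonneg _).trans (hA x hx).2.1)

/-- The divergence identity for the field `a (u ∂_w q e_v - u ∂_v q e_w)`, in which the second
derivatives of `q` cancel. -/
lemma integral_wedge (ha : IsTame a a') (v w : Space3) {u q : Space3 → ℝ}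
    (hu : ContDiff ℝ 2 u) (hq : ContDiff ℝ 2 q) (hc : HasCompactSupport u) :
    Integrable (fun x => a x * (fderiv ℝ u x v * fderiv ℝ q x w - fderiv ℝ u x w * fderiv ℝ q x v)
        + a' x v * (u x * fderiv ℝ q x w) - a' x w * (u x * fderiv ℝ q x v)) ∧
      ∫ x, (a x * (fderiv ℝ u x v * fderiv ℝ q x w - fderiv ℝ u x w * fderiv ℝ q x v)
        + a' x v * (u x * fderiv ℝ q x w) - a' x w * (u x * fderiv ℝ q x v)) = 0 := by
  have hu1 : ContDiff ℝ 1 u := hu.of_le (by norm_num)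
  have hq1 : ContDiff ℝ 1 (fderiv ℝ q) := hq.fderiv_right (by norm_num)
  have hd : ∀ z, ContDiff ℝ 1 (fun x => fderiv ℝ q x z) := fun z => hq1.clm_apply contDiff_const
  have hψ : ∀ z, ContDiff ℝ 1 (fun x => u x * fderiv ℝ q x z) := fun z => hu1.mul (hd z)
  have hfd : ∀ x y z, fderiv ℝ (fun x => u x * fderiv ℝ q x z) x y =
      u x * fderiv ℝ (fderiv ℝ q) x y z + fderiv ℝ q x z * fderiv ℝ u x y := by
    intro x y z
    have h1 : HasFDerivAt (fun x => fderiv ℝ q x z) ((fderiv ℝ (fderiv ℝ q) x).flip z) x :=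
      (hq1.differentiable one_ne_zero x).hasFDerivAt.clm_apply (hasFDerivAt_const z x) |>.congr_fderiv
        (by ext; simp)
    have h2 : HasFDerivAt (fun x => u x * fderiv ℝ q x z) _ x :=
      (hu1.differentiable one_ne_zero x).hasFDerivAt.mul h1
    rw [h2.fderiv]
    simp
  have hsymm : ∀ x, fderiv ℝ (fderiv ℝ q) x v w = fderiv ℝ (fderiv ℝ q) x w v := fun x =>
    (hq.contDiffAt.isSymmSndFDerivAt (by simp)) v w
  obtain ⟨i1, e1⟩ := ha.integral_deriv_mul_add v (hψ w) hc.mul_right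
  obtain ⟨i2, e2⟩ := ha.integral_deriv_mul_add w (hψ v) hc.mul_right
  have heq : ∀ x, a x * (fderiv ℝ u x v * fderiv ℝ q x w - fderiv ℝ u x w * fderiv ℝ q x v)
        + a' x v * (u x * fderiv ℝ q x w) - a' x w * (u x * fderiv ℝ q x v) =
      (a' x v * (u x * fderiv ℝ q x w) + a x * fderiv ℝ (fun x => u x * fderiv ℝ q x w) x v) -
      (a' x w * (u x * fderiv ℝ q x v) + a x * fderiv ℝ (fun x => u x * fderiv ℝ q x v) x w) := by
    intro x
    rw [hfd, hfd, hsymm]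
    ring
  simp only [heq]
  exact ⟨i1.sub i2, by rw [integral_sub i1 i2, e1, e2, sub_zero]⟩

end IsTame

/-- The weight `‖x‖ / (1 + ‖x‖)`. -/
def radialWeight (x : Space3) : ℝ := ‖x‖ / (1 + ‖x‖)

/-- The derivative of `radialWeight`. -/
def radialWeightDeriv (x : Space3) : Space3 →L[ℝ] ℝ :=
  (‖x‖⁻¹ / (1 + ‖x‖) ^ 2) • innerSL ℝ x

lemma isTame_radialWeight : IsTame radialWeight radialWeightDeriv := by
  refine ⟨1, fun x hx => ?_⟩
  have hr : 0 < ‖x‖ := norm_pos_iff.2 hx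
  refine ⟨?_, ?_, ?_⟩
  · have hne : 1 + ‖x‖ ≠ 0 := by positivity
    have h1 : HasDerivAt (fun t : ℝ => t / (1 + t)) (1 / (1 + ‖x‖) ^ 2) ‖x‖ := by
      refine ((hasDerivAt_id ‖x‖).div ((hasDerivAt_id ‖x‖).const_add 1) hne).congr_deriv ?_
      simp
    refine (h1.comp_hasFDerivAt x (hasFDerivAt_norm_of_ne_zero hx)).congr_fderiv ?_
    ext v
    simp [radialWeightDeriv]
    ring
  · rw [radialWeight, abs_of_pos (by positivity), div_le_one (by positivity)]
    linarith
  · rw [radialWeightDeriv, norm_smul, innerSL_apply_norm, Real.norm_eq_abs,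
      abs_of_pos (by positivity)]
    field_simp
    nlinarith

/-- The coordinate `x i / ‖x‖` of the unit radial vector. -/
def unitCoord (i : Fin 3) (x : Space3) : ℝ := x i / ‖x‖

/-- The derivative of `unitCoord`. -/
def unitCoordDeriv (i : Fin 3) (x : Space3) : Space3 →L[ℝ] ℝ :=
  ‖x‖⁻¹ • EuclideanSpace.proj i - (x i * (‖x‖⁻¹) ^ 3) • innerSL ℝ x

lemma isTame_unitCoord (i : Fin 3) : IsTame (unitCoord i) (unitCoordDeriv i) := by
  refine ⟨2, fun x hx => ?_⟩
  have hr : 0 < ‖x‖ := norm_pos_iff.2 hx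
  have hxi : |x i| ≤ ‖x‖ := PiLp.norm_apply_le x i
  refine ⟨?_, ?_, ?_⟩
  · have h1 : HasFDerivAt (fun x : Space3 => x i) (EuclideanSpace.proj i : Space3 →L[ℝ] ℝ) x :=
      (EuclideanSpace.proj i : Space3 →L[ℝ] ℝ).hasFDerivAt
    have h2 := h1.mul ((hasDerivAt_inv hr.ne').comp_hasFDerivAt x (hasFDerivAt_norm_of_ne_zero hx))
    refine (h2.congr_fderiv ?_)
    ext v
    simp [unitCoordDeriv]
    field_simp
    ring
  · rw [unitCoord, abs_div, abs_of_pos hr, div_le_iff₀ hr]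
    linarith
  · have hp : ‖(EuclideanSpace.proj i : Space3 →L[ℝ] ℝ)‖ ≤ 1 :=
      ContinuousLinearMap.opNorm_le_bound _ zero_le_one fun v => by
        simpa using PiLp.norm_apply_le v i
    have h1 : ‖unitCoordDeriv i x‖ ≤ ‖x‖⁻¹ * 1 + ‖x‖ * (‖x‖⁻¹) ^ 3 * ‖x‖ := by
      refine (norm_sub_le _ _).trans ?_
      rw [norm_smul, norm_smul, innerSL_apply_norm, norm_inv, norm_norm, norm_mul, norm_pow,
        norm_inv, norm_norm]
      gcongr
      exact hxi
    calc _ ≤ ‖x‖ * (‖x‖⁻¹ * 1 + ‖x‖ * (‖x‖⁻¹) ^ 3 * ‖x‖) := by gcongr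
      _ = 2 := by field_simp; norm_num

/-- The Pauli matrix `σ_j` acting on `ℂ²`, in the real coordinates
`(Re v₀, Im v₀, Re v₁, Im v₁)`. -/
def pauliAct (j : Fin 3) (v : Fin 4 → ℝ) : Fin 4 → ℝ :=
  ![![v 2, v 3, v 0, v 1], ![v 3, -v 2, -v 1, v 0], ![v 0, v 1, -v 2, -v 3]] j

/-- The real form `Re ⟨u, i σ_m q⟩` in real coordinates. -/
def spinForm (m : Fin 3) (u q : Fin 4 → ℝ) : ℝ :=
  ![-u 0 * q 3 + u 1 * q 2 - u 2 * q 1 + u 3 * q 0,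
    u 0 * q 2 + u 1 * q 3 - u 2 * q 0 - u 3 * q 1,
    -u 0 * q 1 + u 1 * q 0 + u 2 * q 3 - u 3 * q 2] m

/-- `|σ·L|² ≤ 2 |L|²` for spinor-valued vectors `L` orthogonal to a nonzero vector. -/
lemma norm_pauli_sq_le_of_orthogonal {x : Fin 3 → ℝ} (hx : 0 < ∑ j, x j ^ 2)
    {L : Fin 3 → Fin 4 → ℝ} (hL : ∀ a, ∑ j, x j * L j a = 0) :
    ∑ a, (∑ j, pauliAct j (L j) a) ^ 2 ≤ 2 * ∑ j, ∑ a, L j a ^ 2 := by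
  set V : Fin 4 → ℝ := fun a => ∑ j, pauliAct j (L j) a with hV
  set R : ℝ := ∑ j, x j ^ 2 with hR
  let G : Fin 3 → Fin 4 → ℝ := fun j a =>
    R * pauliAct j V a - x j * ∑ k, x k * pauliAct k V a
  have h1 : ∑ j, ∑ a, G j a ^ 2 = 2 * R ^ 2 * ∑ a, V a ^ 2 := by
    clear_value V
    simp [G, hR, Fin.sum_univ_succ, pauliAct]
    ring
  have h2 : ∑ j, ∑ a, G j a * L j a = R * ∑ a, V a ^ 2 := by
    have h3 : ∑ j, ∑ a, pauliAct j V a * L j a = ∑ a, V a ^ 2 := by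
      simp [hV, Fin.sum_univ_succ, pauliAct]
      ring
    have h4 : ∑ j, ∑ a, G j a * L j a = R * ∑ j, ∑ a, pauliAct j V a * L j a -
        ∑ a, (∑ k, x k * pauliAct k V a) * ∑ j, x j * L j a := by
      simp only [Fin.sum_univ_three, Fin.sum_univ_four, G]
      ring
    simp [h4, h3, hL]
  have h5 : 0 ≤ ∑ j, ∑ a, (2 * R * L j a - G j a) ^ 2 := by positivity
  have h6 : ∑ j, ∑ a, (2 * R * L j a - G j a) ^ 2 = 4 * R ^ 2 * ∑ j, ∑ a, L j a ^ 2 -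
      4 * R * ∑ j, ∑ a, G j a * L j a + ∑ j, ∑ a, G j a ^ 2 := by
    simp only [Fin.sum_univ_three, Fin.sum_univ_four]
    ring
  rw [h6, h1, h2] at h5
  have h7 : 0 ≤ 2 * R ^ 2 * (2 * ∑ j, ∑ a, L j a ^ 2 - ∑ a, V a ^ 2) := by linarith
  have := nonneg_of_mul_nonneg_right h7 (by positivity)
  linarith

/-- The divergence of the field `t (Re ⟨u, i σ_m ∂_{l+2} u⟩ e_{l+1} - Re ⟨u, i σ_m ∂_{l+1} u⟩ e_{l+2})`,
where `dt` is the gradient of `t` and `p` is the gradient of `u`. -/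
def spinWedge (l m : Fin 3) (t : ℝ) (dt : Fin 3 → ℝ) (u : Fin 4 → ℝ) (p : Fin 3 → Fin 4 → ℝ) : ℝ :=
  t * (spinForm m (p (l + 1)) (p (l + 2)) - spinForm m (p (l + 2)) (p (l + 1))) +
    dt (l + 1) * spinForm m u (p (l + 2)) - dt (l + 2) * spinForm m u (p (l + 1))

/-- The spin-orbit term `-Re ⟨u, (σ·L) u⟩`. -/
def spinOrbit (x : Fin 3 → ℝ) (u : Fin 4 → ℝ) (p : Fin 3 → Fin 4 → ℝ) : ℝ :=
  ∑ l, (x (l + 1) * spinForm l u (p (l + 2)) - x (l + 2) * spinForm l u (p (l + 1)))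

/-- The vector product `x × p`. -/
def angular (x : Fin 3 → ℝ) (p : Fin 3 → Fin 4 → ℝ) (l : Fin 3) (a : Fin 4) : ℝ :=
  x (l + 1) * p (l + 2) a - x (l + 2) * p (l + 1) a

section Algebra

variable (x : Fin 3 → ℝ) (u : Fin 4 → ℝ) (p : Fin 3 → Fin 4 → ℝ)

lemma sum_mul_angular (a : Fin 4) : ∑ l, x l * angular x p l a = 0 := by
  simp [angular, Fin.sum_univ_three]
  ring

lemma sum_angular_sq : ∑ l, ∑ a, angular x p l a ^ 2 =
    (∑ j, x j ^ 2) * (∑ j, ∑ a, p j a ^ 2) - ∑ a, (∑ j, x j * p j a) ^ 2 := by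
  simp [angular, Fin.sum_univ_three, Fin.sum_univ_four]
  ring

lemma sum_spinWedge_diag (w c : ℝ) :
    ∑ l, spinWedge l l w (fun j => c * x j) u p =
      w * (∑ a, (∑ j, pauliAct j (p j) a) ^ 2 - ∑ j, ∑ a, p j a ^ 2) + c * spinOrbit x u p := by
  simp [spinWedge, spinOrbit, spinForm, pauliAct, Fin.sum_univ_three, Fin.sum_univ_four]
  ring

lemma sum_spinWedge_tangential (h k : ℝ) :
    ∑ l, ∑ m, spinWedge l m (h * x l * x m) (fun j => k * x l * x m * x j +
      h * ((if l = j then 1 else 0) * x m + (if m = j then 1 else 0) * x l)) u p =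
      h * (∑ a, (∑ j, pauliAct j (angular x p j) a) ^ 2 - ∑ l, ∑ a, angular x p l a ^ 2) -
        h * spinOrbit x u p := by
  simp [spinWedge, spinOrbit, spinForm, pauliAct, angular, Fin.sum_univ_three, Fin.sum_univ_four]
  ring

end Algebra

/-- The partial derivative `∂_j (x_i / r)` in terms of `x` and `r = |x|`. -/
def unitCoordPartial (x : Fin 3 → ℝ) (r : ℝ) (i j : Fin 3) : ℝ :=
  r⁻¹ * (if i = j then 1 else 0) - x i * r⁻¹ ^ 3 * x j

/-- The partial derivative `∂_j (r / (1 + r))` in terms of `x` and `r = |x|`. -/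
def radialWeightPartial (x : Fin 3 → ℝ) (r : ℝ) (j : Fin 3) : ℝ :=
  r⁻¹ / (1 + r) ^ 2 * x j

/-- The total divergence, in terms of the values `u` and the gradient `p` of a spinor at `x`. -/
def totalDivergence (x : Fin 3 → ℝ) (r : ℝ) (u : Fin 4 → ℝ) (p : Fin 3 → Fin 4 → ℝ) : ℝ :=
  ∑ l, spinWedge l l (r / (1 + r)) (radialWeightPartial x r) u p +
    ∑ l, ∑ m, spinWedge l m (r / (1 + r) * (1 - r / (1 + r)) * (x l / r) * (x m / r))
      (fun j => r / (1 + r) * (1 - r / (1 + r)) * (x l / r) * unitCoordPartial x r m j +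
        x m / r * (r / (1 + r) * (1 - r / (1 + r)) * unitCoordPartial x r l j +
          x l / r * (r / (1 + r) * -radialWeightPartial x r j +
            (1 - r / (1 + r)) * radialWeightPartial x r j))) u p -
    ∑ j, ∑ a, (unitCoordPartial x r j j * (u a * u a) + x j / r * (u a * p j a + u a * p j a))

lemma totalDivergence_le {x : Fin 3 → ℝ} {r : ℝ} (hr : 0 < r) (hx : ∑ j, x j ^ 2 = r ^ 2)
    (u : Fin 4 → ℝ) (p : Fin 3 → Fin 4 → ℝ) :
    totalDivergence x r u p ≤
      r / (1 + r) * ∑ a, (∑ j, pauliAct j (p j) a) ^ 2 + ∑ a, u a ^ 2 - r⁻¹ * ∑ a, u a ^ 2 := by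
  have h1r : 0 < 1 + r := by linarith
  set h : ℝ := r⁻¹ / (1 + r) ^ 2 with hh
  set k : ℝ := -(1 + 3 * r) / (r ^ 3 * (1 + r) ^ 3) with hk
  have e1 : ∑ l, spinWedge l l (r / (1 + r)) (radialWeightPartial x r) u p = _ :=
    sum_spinWedge_diag x u p (r / (1 + r)) h
  have e2 := sum_spinWedge_tangential x u p h k
  have e3 : ∀ l m : Fin 3, r / (1 + r) * (1 - r / (1 + r)) * (x l / r) * (x m / r) =
      h * x l * x m := fun l m => by
    rw [hh]
    field_simp
    ring
  have e4 : ∀ l m : Fin 3,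
      (fun j => r / (1 + r) * (1 - r / (1 + r)) * (x l / r) * unitCoordPartial x r m j +
        x m / r * (r / (1 + r) * (1 - r / (1 + r)) * unitCoordPartial x r l j +
          x l / r * (r / (1 + r) * -radialWeightPartial x r j +
            (1 - r / (1 + r)) * radialWeightPartial x r j))) =
      fun j => k * x l * x m * x j +
        h * ((if l = j then 1 else 0) * x m + (if m = j then 1 else 0) * x l) := by
    intro l m
    funext j
    rw [hh, hk, unitCoordPartial, unitCoordPartial, radialWeightPartial]
    generalize (if l = j then (1 : ℝ) else 0) = dl
    generalize (if m = j then (1 : ℝ) else 0) = dm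
    field_simp
    ring
  have e5 : ∑ j, ∑ a, (unitCoordPartial x r j j * (u a * u a) +
      x j / r * (u a * p j a + u a * p j a)) =
      2 / r * ∑ a, u a ^ 2 + 2 / r * ∑ a, u a * ∑ j, x j * p j a := by
    have e6 : ∑ j, unitCoordPartial x r j j = 2 / r := by
      have : ∑ j, unitCoordPartial x r j j = 3 * r⁻¹ - r⁻¹ ^ 3 * ∑ j, x j ^ 2 := by
        simp [unitCoordPartial, Fin.sum_univ_three]
        ring
      rw [this, hx]
      field_simp
      norm_num
    trans (∑ j, unitCoordPartial x r j j) * ∑ a, u a ^ 2 + 2 / r * ∑ a, u a * ∑ j, x j * p j a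
    · simp only [Fin.sum_univ_three, Fin.sum_univ_four]
      ring
    · rw [e6]
  have e7 := norm_pauli_sq_le_of_orthogonal (x := x) (by rw [hx]; positivity) (sum_mul_angular x p)
  have e8 := sum_angular_sq x p
  rw [hx] at e8
  have e9 : 0 ≤ r / (1 + r) * ∑ a, ((∑ j, x j * p j a) / r + (1 + r⁻¹) * u a) ^ 2 := by positivity
  have e10 : r / (1 + r) * ∑ a, ((∑ j, x j * p j a) / r + (1 + r⁻¹) * u a) ^ 2 =
      r⁻¹ / (1 + r) * ∑ a, (∑ j, x j * p j a) ^ 2 + 2 / r * ∑ a, u a * ∑ j, x j * p j a +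
        (1 + r⁻¹) * ∑ a, u a ^ 2 := by
    simp only [Fin.sum_univ_four]
    field_simp
    ring
  have hL0 : 0 ≤ ∑ l, ∑ a, angular x p l a ^ 2 := by positivity
  simp only [totalDivergence, e3, e4]
  rw [e1, e2, e5]
  generalize ∑ a, (∑ j, pauliAct j (p j) a) ^ 2 = P at *
  generalize ∑ a, (∑ j, pauliAct j (angular x p j) a) ^ 2 = Q at *
  generalize ∑ l, ∑ a, angular x p l a ^ 2 = A at *
  generalize ∑ j, ∑ a, p j a ^ 2 = N at *
  generalize ∑ a, (∑ j, x j * p j a) ^ 2 = D at *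
  generalize ∑ a, u a * ∑ j, x j * p j a = M at *
  generalize ∑ a, u a ^ 2 = U at *
  rw [e10] at e9
  have e11 : r / (1 + r) * N = r⁻¹ / (1 + r) * D + h * (1 + r) * A := by
    rw [e8, hh]
    field_simp
    ring
  have hpos : 0 < h := by positivity
  have e12 : 0 ≤ h * (2 * A - Q) := mul_nonneg hpos.le (by linarith)
  have e13 : 0 ≤ h * r * A := by positivity
  have e14 : 2 / r * U = 2 * (r⁻¹ * U) := by ring
  linarith

/-- A function which is integrable with vanishing integral. -/
def IntegratesToZero (f : Space3 → ℝ) : Prop := Integrable f ∧ ∫ x, f x = 0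

namespace IntegratesToZero

variable {f g : Space3 → ℝ}

lemma add (hf : IntegratesToZero f) (hg : IntegratesToZero g) :
    IntegratesToZero (fun x => f x + g x) :=
  ⟨hf.1.add hg.1, by rw [integral_add hf.1 hg.1, hf.2, hg.2, add_zero]⟩

lemma sub (hf : IntegratesToZero f) (hg : IntegratesToZero g) :
    IntegratesToZero (fun x => f x - g x) :=
  ⟨hf.1.sub hg.1, by rw [integral_sub hf.1 hg.1, hf.2, hg.2, sub_zero]⟩

lemma sum {ι : Type*} {s : Finset ι} {F : ι → Space3 → ℝ}
    (hF : ∀ i ∈ s, IntegratesToZero (F i)) : IntegratesToZero (fun x => ∑ i ∈ s, F i x) :=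
  ⟨integrable_finsetSum s fun i hi => (hF i hi).1, by
    rw [integral_finsetSum s fun i hi => (hF i hi).1]
    exact Finset.sum_eq_zero fun i hi => (hF i hi).2⟩

end IntegratesToZero

/-- The `j`-th standard basis vector. -/
abbrev basisVec (j : Fin 3) : Space3 := EuclideanSpace.single j (1 : ℝ)

lemma IsTame.integratesToZero_spinWedge {t : Space3 → ℝ} {t' : Space3 → Space3 →L[ℝ] ℝ}
    (ht : IsTame t t') (l m : Fin 3) {f : Fin 4 → Space3 → ℝ} (hf : ∀ a, ContDiff ℝ 2 (f a))
    (hc : ∀ a, HasCompactSupport (f a)) :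
    IntegratesToZero fun x => spinWedge l m (t x) (fun j => t' x (basisVec j)) (fun a => f a x)
      (fun j a => fderiv ℝ (f a) x (basisVec j)) := by
  have key : ∀ a b, IntegratesToZero _ := fun a b =>
    ht.integral_wedge (basisVec (l + 1)) (basisVec (l + 2)) (hf a) (hf b) (hc a)
  fin_cases m
  · convert ((key 1 2).sub (key 0 3)).add ((key 3 0).sub (key 2 1)) using 2 with x
    simp [spinWedge, spinForm]
    ring
  · convert ((key 0 2).add (key 1 3)).sub ((key 2 0).add (key 3 1)) using 2 with x
    simp [spinWedge, spinForm]
    ring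
  · convert ((key 1 0).sub (key 0 1)).add ((key 2 3).sub (key 3 2)) using 2 with x
    simp [spinWedge, spinForm]
    ring

lemma radialWeightDeriv_basisVec (x : Space3) (j : Fin 3) :
    radialWeightDeriv x (basisVec j) = radialWeightPartial x ‖x‖ j := by
  simp [radialWeightDeriv, radialWeightPartial, EuclideanSpace.inner_single_right]

lemma unitCoordDeriv_basisVec (x : Space3) (i j : Fin 3) :
    unitCoordDeriv i x (basisVec j) = unitCoordPartial x ‖x‖ i j := by
  simp [unitCoordDeriv, unitCoordPartial, EuclideanSpace.inner_single_right]

lemma integratesToZero_totalDivergence {f : Fin 4 → Space3 → ℝ} (hf : ∀ a, ContDiff ℝ 2 (f a))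
    (hc : ∀ a, HasCompactSupport (f a)) :
    IntegratesToZero fun x => totalDivergence x ‖x‖ (fun a => f a x)
      (fun j a => fderiv ℝ (f a) x (basisVec j)) := by
  have hw := isTame_radialWeight
  have h1 : ∀ l, IntegratesToZero _ := fun l => hw.integratesToZero_spinWedge l l hf hc
  have h2 : ∀ l m, IntegratesToZero _ := fun l m =>
    (((hw.mul hw.one_sub).mul (isTame_unitCoord l)).mul
      (isTame_unitCoord m)).integratesToZero_spinWedge l m hf hc
  have h3 : ∀ j a, IntegratesToZero _ := fun j a =>
    (isTame_unitCoord j).integral_deriv_mul_add (basisVec j)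
      (((hf a).mul (hf a)).of_le (by norm_num : (1 : WithTop ℕ∞) ≤ 2)) (hc a).mul_right
  have h4 : ∀ a x v, fderiv ℝ (fun x => f a x * f a x) x v =
      f a x * fderiv ℝ (f a) x v + f a x * fderiv ℝ (f a) x v := by
    intro a x v
    have hd := ((hf a).differentiable (by norm_num) x).hasFDerivAt
    have h2 : HasFDerivAt (fun x => f a x * f a x) _ x := hd.mul hd
    rw [h2.fderiv]
    simp
  convert ((IntegratesToZero.sum (s := Finset.univ) fun l _ => h1 l).add
    (IntegratesToZero.sum (s := Finset.univ) fun l _ =>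
      IntegratesToZero.sum (s := Finset.univ) fun m _ => h2 l m)).sub
    (IntegratesToZero.sum (s := Finset.univ) fun j _ =>
      IntegratesToZero.sum (s := Finset.univ) fun a _ => h3 j a) using 2 with x
  simp only [totalDivergence, h4, radialWeightDeriv_basisVec, unitCoordDeriv_basisVec,
    add_apply, smul_apply, neg_apply, smul_eq_mul, radialWeight, unitCoord]

/-- The real coordinates `(Re v₀, Im v₀, Re v₁, Im v₁)` of a spinor. -/
def spinorCoord (a : Fin 4) : EuclideanSpace ℂ (Fin 2) →L[ℝ] ℝ :=
  ![Complex.reCLM ∘L (EuclideanSpace.proj 0 : EuclideanSpace ℂ (Fin 2) →L[ℂ] ℂ).restrictScalars ℝ,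
    Complex.imCLM ∘L (EuclideanSpace.proj 0 : EuclideanSpace ℂ (Fin 2) →L[ℂ] ℂ).restrictScalars ℝ,
    Complex.reCLM ∘L (EuclideanSpace.proj 1 : EuclideanSpace ℂ (Fin 2) →L[ℂ] ℂ).restrictScalars ℝ,
    Complex.imCLM ∘L (EuclideanSpace.proj 1 : EuclideanSpace ℂ (Fin 2) →L[ℂ] ℂ).restrictScalars ℝ]
    a

lemma norm_sq_eq_sum_spinorCoord (v : EuclideanSpace ℂ (Fin 2)) :
    ‖v‖ ^ 2 = ∑ a, spinorCoord a v ^ 2 := by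
  simp [EuclideanSpace.norm_sq_eq, Fin.sum_univ_four, spinorCoord, Complex.sq_norm,
    Complex.normSq_apply]
  ring

lemma norm_pauliGrad_sq (φ : Space3 → EuclideanSpace ℂ (Fin 2)) (x : Space3) :
    ‖pauliGrad φ x‖ ^ 2 =
      ∑ a, (∑ j, pauliAct j (fun b => spinorCoord b (fderiv ℝ φ x (basisVec j))) a) ^ 2 := by
  rw [norm_sq_eq_sum_spinorCoord]
  simp [pauliGrad, Fin.sum_univ_four, Fin.sum_univ_three, spinorCoord, pauliAct]
  ring

lemma continuous_pauliGrad {φ : Space3 → EuclideanSpace ℂ (Fin 2)} (hφ : ContDiff ℝ 1 φ) :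
    Continuous (pauliGrad φ) := by
  have h : ∀ j, Continuous fun x => fderiv ℝ φ x (basisVec j) := fun j =>
    (hφ.continuous_fderiv one_ne_zero).clm_apply continuous_const
  have hj : ∀ j i, Continuous fun x => fderiv ℝ φ x (basisVec j) i := fun j i =>
    (EuclideanSpace.proj i : EuclideanSpace ℂ (Fin 2) →L[ℂ] ℂ).continuous.comp (h j)
  refine (PiLp.continuous_toLp 2 _).comp (continuous_pi fun i => ?_)
  fin_cases i
  · exact ((hj 0 1).sub (continuous_const.mul (hj 1 1))).add (hj 2 0)
  · exact ((hj 0 0).add (continuous_const.mul (hj 1 0))).sub (hj 2 1)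

lemma hasCompactSupport_pauliGrad {φ : Space3 → EuclideanSpace ℂ (Fin 2)}
    (hφ : HasCompactSupport φ) : HasCompactSupport (pauliGrad φ) := by
  refine (hφ.fderiv ℝ).mono' (fun x hx => subset_tsupport _ ?_)
  contrapose! hx
  have h0 : fderiv ℝ φ x = 0 := by simpa using hx
  have : ‖pauliGrad φ x‖ ^ 2 = 0 := by
    rw [norm_pauliGrad_sq]
    simp [h0, Fin.sum_univ_four, Fin.sum_univ_three, pauliAct]
  simpa using this

/-- The Hardy-type inequality for the Pauli operator, with all integrals finite. -/
lemma hardy_dirac {φ : Space3 → EuclideanSpace ℂ (Fin 2)} (hφ : IsTestFun φ) :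
    Integrable (fun x => ‖x‖⁻¹ * ‖φ x‖ ^ 2) ∧
      ∫ x, ‖x‖⁻¹ * ‖φ x‖ ^ 2 ≤
        ∫ x, (‖pauliGrad φ x‖ ^ 2 / (1 + 1 / ‖x‖) + ‖φ x‖ ^ 2) := by
  obtain ⟨hs, hc⟩ := hφ
  have hs2 : ContDiff ℝ 2 φ := hs.of_le (WithTop.coe_le_coe.2 (le_top : (2 : ℕ∞) ≤ ⊤))
  have hcont : Continuous fun x => ‖φ x‖ ^ 2 := hs.continuous.norm.pow 2
  have hcs : HasCompactSupport fun x => ‖φ x‖ ^ 2 :=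
    hc.norm.comp_left (g := fun t => t ^ 2) (by simp)
  have hi1 : Integrable (fun x => ‖x‖⁻¹ * ‖φ x‖ ^ 2) := by
    obtain ⟨C, hC⟩ := hcs.exists_bound_of_continuous hcont
    exact integrable_inv_norm_mul hcont.aestronglyMeasurable (fun x _ => hC x) hcs
  have hi2 : Integrable (fun x => ‖φ x‖ ^ 2) := hcont.integrable_of_hasCompactSupport hcs
  have hi3 : Integrable (fun x => radialWeight x * ‖pauliGrad φ x‖ ^ 2) :=
    isTame_radialWeight.integrable_mul
      ((continuous_pauliGrad (hs2.of_le (by norm_num))).norm.pow 2)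
      ((hasCompactSupport_pauliGrad hc).norm.comp_left (g := fun t => t ^ 2) (by simp))
  have heq : ∫ x, (‖pauliGrad φ x‖ ^ 2 / (1 + 1 / ‖x‖) + ‖φ x‖ ^ 2) =
      ∫ x, (radialWeight x * ‖pauliGrad φ x‖ ^ 2 + ‖φ x‖ ^ 2) := by
    refine integral_congr_ae ?_
    filter_upwards [ae_ne_zero] with x hx
    have hr : 0 < ‖x‖ := norm_pos_iff.2 hx
    rw [radialWeight]
    field_simp
    ring
  refine ⟨hi1, ?_⟩
  obtain ⟨hT, hT0⟩ := integratesToZero_totalDivergence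
    (f := fun a x => spinorCoord a (φ x)) (fun a => (spinorCoord a).contDiff.comp hs2)
    (fun a => hc.comp_left (map_zero _))
  have hle := integral_mono_ae hT ((hi3.add hi2).sub hi1) (by
    filter_upwards [ae_ne_zero] with x hx
    have hr : 0 < ‖x‖ := norm_pos_iff.2 hx
    have hd : ∀ a v, fderiv ℝ (fun x => spinorCoord a (φ x)) x v =
        spinorCoord a (fderiv ℝ φ x v) := by
      intro a v
      have := (spinorCoord a).hasFDerivAt.comp x
        (hs2.differentiable (by norm_num) x).hasFDerivAt
      have h2 : HasFDerivAt (fun x => spinorCoord a (φ x)) _ x := this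
      rw [h2.fderiv]
      simp
    have h := totalDivergence_le (x := x) hr
      (by rw [EuclideanSpace.norm_sq_eq]; simp) (fun a => spinorCoord a (φ x))
      (fun j a => spinorCoord a (fderiv ℝ φ x (basisVec j)))
    rw [← norm_pauliGrad_sq, ← norm_sq_eq_sum_spinorCoord] at h
    simpa only [hd, Pi.add_apply, Pi.sub_apply, radialWeight] using h)
  rw [hT0] at hle
  have hsub := integral_sub (hi3.add hi2) hi1
  simp only [Pi.add_apply, Pi.sub_apply] at hle hsub
  rw [heq]
  linarith

/-- For `V ≤ 0` with `|x||V(x)| ≤ ν < 1`, the potential energy is controlled by the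
Hardy–Dirac form: `-∫ V|φ|² dx ≤ ν ∫ (|σ·∇φ|²/(1 + 1/|x|) + |φ|²) dx`. -/
theorem potential_energy_bound
    (ν : ℝ) (hν : ν ∈ Set.Ioo (0 : ℝ) 1)
    (V : EuclideanSpace ℝ (Fin 3) → ℝ)
    (hV0 : ∀ x : EuclideanSpace ℝ (Fin 3), x ≠ 0 → V x ≤ 0)
    (hVν : ∀ x : EuclideanSpace ℝ (Fin 3), x ≠ 0 → ‖x‖ * |V x| ≤ ν)
    (φ : EuclideanSpace ℝ (Fin 3) → EuclideanSpace ℂ (Fin 2)) (hφ : IsTestFun φ) :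
    -∫ x, V x * ‖φ x‖ ^ 2 ≤
      ν * ∫ x, (‖pauliGrad φ x‖ ^ 2 / (1 + 1 / ‖x‖) + ‖φ x‖ ^ 2) := by
  obtain ⟨hi, hle⟩ := hardy_dirac hφ
  refine le_trans ?_ (mul_le_mul_of_nonneg_left hle hν.1.le)
  by_cases hV : Integrable (fun x => V x * ‖φ x‖ ^ 2)
  · rw [← integral_neg, ← integral_const_mul]
    refine integral_mono_ae hV.neg (hi.const_mul ν) ?_
    filter_upwards [ae_ne_zero] with x hx
    have hr : 0 < ‖x‖ := norm_pos_iff.2 hx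
    have h1 := hVν x hx
    rw [abs_of_nonpos (hV0 x hx)] at h1
    have h2 : -V x ≤ ν * ‖x‖⁻¹ := by
      rwa [← div_eq_mul_inv, le_div_iff₀' hr]
    have := mul_le_mul_of_nonneg_right h2 (sq_nonneg ‖φ x‖)
    linarith
  · rw [integral_undef hV, neg_zero]
    exact mul_nonneg hν.1.le (integral_nonneg fun x => by positivity)

end
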